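/- arXiv:0907.1172 — 3 statements merged into one kernel-verified Lean document; each statement's English description precedes it below -/
import Mathlib

section
/- Let S = U(ℤ/2ℤ × ℤ/2ℤ, ℤ/2ℤ, π), where π(x,y) = x, both semigroups carry componentwise addition and the identical involution, and (0,0) ∈ ℤ/2ℤ × ℤ/2ℤ is the neutral element of S. Then (1,0) + s ≠ s for every s ∈ S, whereas (0,1) + s ≠ s holds exactly for the four elements s belonging to the ℤ/2ℤ × ℤ/2ℤ part of S. Consequently, for every positive definite function φ : S → ℂ, the number of negative squares of s ↦ φ(s+(1,0)) is at most 3 and the number of negative squares of s ↦ φ(s+(0,1)) is at most 2. -/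
open scoped ComplexOrder

/-- `φ : S → ℂ` is positive definite on the commutative `*`-semigroup `(S, add, st)`. -/
def IsPosDefFn {S : Type*} (add : S → S → S) (st : S → S) (φ : S → ℂ) : Prop :=
  ∀ (n : ℕ) (s : Fin n → S) (ξ : Fin n → ℂ),
    0 ≤ ∑ i, ∑ j, ξ i * starRingEnd ℂ (ξ j) * φ (add (st (s j)) (s i))

/-- number of negative eigenvalues (with multiplicities) of a Hermitian matrix. -/
noncomputable def negEigCount {n : ℕ} {A : Matrix (Fin n) (Fin n) ℂ}
    (hA : A.IsHermitian) : ℕ :=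
  (Finset.univ.filter fun i => hA.eigenvalues i < 0).card

/-- The number of negative squares of `ψ` is at most `k`: every Hermitian matrix
`(ψ (sᵢ + sⱼ*))ᵢⱼ` has at most `k` negative eigenvalues, counted with multiplicities. -/
def NegSquaresLE {S : Type*} (add : S → S → S) (st : S → S) (ψ : S → ℂ) (k : ℕ) : Prop :=
  ∀ (n : ℕ) (s : Fin n → S)
    (h : (Matrix.of fun i j : Fin n => ψ (add (s i) (st (s j)))).IsHermitian),
    negEigCount h ≤ k

/-- `ψ` has a finite number of negative squares. -/
def HasFinNegSquares {S : Type*} (add : S → S → S) (st : S → S) (ψ : S → ℂ) : Prop :=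
  ∃ k, NegSquaresLE add st ψ k

/-- Addition of the `*`-semigroup `U(S,T,h)` on the disjoint union `S ⊕ T`. -/
def uAdd {S T : Type*} (addS : S → S → S) (addT : T → T → T) (h : S → T) :
    S ⊕ T → S ⊕ T → S ⊕ T
  | Sum.inl a, Sum.inl b => Sum.inl (addS a b)
  | Sum.inl a, Sum.inr b => Sum.inr (addT (h a) b)
  | Sum.inr a, Sum.inl b => Sum.inr (addT a (h b))
  | Sum.inr a, Sum.inr b => Sum.inr (addT a b)

/-- Involution of the `*`-semigroup `U(S,T,h)`. -/
def uStar {S T : Type*} (stS : S → S) (stT : T → T) : S ⊕ T → S ⊕ T :=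
  Sum.map stS stT

/-- The addition of `S = U(ℤ/2ℤ × ℤ/2ℤ, ℤ/2ℤ, π)` where `π (x, y) = x`. -/
def add16 : (ZMod 2 × ZMod 2) ⊕ ZMod 2 → (ZMod 2 × ZMod 2) ⊕ ZMod 2 →
    (ZMod 2 × ZMod 2) ⊕ ZMod 2 :=
  uAdd (· + ·) (· + ·) Prod.fst

/-- The (identical) involution of `S = U(ℤ/2ℤ × ℤ/2ℤ, ℤ/2ℤ, π)`. -/
def st16 : (ZMod 2 × ZMod 2) ⊕ ZMod 2 → (ZMod 2 × ZMod 2) ⊕ ZMod 2 :=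
  uStar id id

/-- A Hermitian matrix that is a combination of rank-one terms `c χ • f χ (f χ)ᵀ` with real
vectors `f χ` has at most as many negative eigenvalues as there are indices `χ` outside of which
the coefficients `c` are nonnegative. -/
lemma negEigCount_le_card_of_eq_sum {ι : Type*} [Fintype ι] {n : ℕ}
    {A : Matrix (Fin n) (Fin n) ℂ} (hA : A.IsHermitian) (N : Finset ι) (c : ι → ℂ)
    (f : ι → Fin n → ℤ) (hsum : ∀ i j, A i j = ∑ χ, c χ * f χ i * f χ j)
    (hc : ∀ χ, χ ∉ N → 0 ≤ c χ) : negEigCount hA ≤ N.card := by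
  classical
  by_contra! hlt
  set P : Finset (Fin n) := Finset.univ.filter fun i => hA.eigenvalues i < 0
  let U : Matrix (Fin n) (Fin n) ℂ := hA.eigenvectorUnitary
  let extend : (P → ℂ) →ₗ[ℂ] (Fin n → ℂ) := Function.ExtendByZero.linearMap ℂ Subtype.val
  let restrict : (ι → ℂ) →ₗ[ℂ] (N → ℂ) := LinearMap.funLeft ℂ ℂ Subtype.val
  let F : Matrix ι (Fin n) ℂ := Matrix.of fun χ i => (f χ i : ℂ)
  have hker : LinearMap.ker (restrict ∘ₗ F.mulVecLin ∘ₗ U.mulVecLin ∘ₗ extend) ≠ ⊥ := by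
    apply LinearMap.ker_ne_bot_of_finrank_lt
    simpa [negEigCount] using hlt
  obtain ⟨w, hw, hw0⟩ := Submodule.exists_mem_ne_zero_of_ne_bot hker
  set z : Fin n → ℂ := extend w
  set x : Fin n → ℂ := U.mulVec z with hx
  have hzP : ∀ p : P, z p = w p := fun p =>
    Subtype.val_injective.extend_apply w (0 : Fin n → ℂ) p
  have hzP' : ∀ i, i ∉ P → z i = 0 := fun i hi =>
    Function.extend_apply' w (0 : Fin n → ℂ) i (by rintro ⟨p, rfl⟩; exact hi p.2)
  have hFx : ∀ χ ∈ N, ∑ i, (f χ i : ℂ) * x i = 0 := fun χ hχ =>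
    congrFun (LinearMap.mem_ker.mp hw) ⟨χ, hχ⟩
  have hnonneg : 0 ≤ star x ⬝ᵥ A.mulVec x := by
    have : star x ⬝ᵥ A.mulVec x
        = ∑ χ, c χ * (star (∑ i, (f χ i : ℂ) * x i) * ∑ i, (f χ i : ℂ) * x i) := by
      simp only [dotProduct, Matrix.mulVec, hsum, star_sum, Finset.sum_mul, Finset.mul_sum]
      rw [Finset.sum_congr rfl fun i _ => Finset.sum_comm, Finset.sum_comm]
      refine Finset.sum_congr rfl fun χ _ => ?_
      rw [Finset.sum_comm]
      refine Finset.sum_congr rfl fun i _ => Finset.sum_congr rfl fun j _ => ?_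
      simp
      ring
    rw [this]
    refine Finset.sum_nonneg fun χ _ => ?_
    by_cases hχ : χ ∈ N
    · simp [hFx χ hχ]
    · exact mul_nonneg (hc χ hχ) (star_mul_self_nonneg _)
  have hdiag : star x ⬝ᵥ A.mulVec x = ((∑ i, hA.eigenvalues i * ‖z i‖ ^ 2 : ℝ) : ℂ) := by
    have hD : star U * A * U = Matrix.diagonal (RCLike.ofReal ∘ hA.eigenvalues) := by
      have := hA.conjStarAlgAut_star_eigenvectorUnitary
      rwa [Unitary.conjStarAlgAut_star_apply] at this
    rw [hx, Matrix.star_mulVec, ← Matrix.dotProduct_mulVec, Matrix.mulVec_mulVec,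
      Matrix.mulVec_mulVec, ← Matrix.star_eq_conjTranspose, hD]
    simp only [dotProduct, Matrix.mulVec_diagonal, Complex.ofReal_sum, Complex.ofReal_mul]
    refine Finset.sum_congr rfl fun i _ => ?_
    have := Complex.conj_mul' (z i)
    simp only [Pi.star_apply, Function.comp_apply, Complex.ofReal_pow, ← this]
    simp
    ring
  have hneg : ∑ i, hA.eigenvalues i * ‖z i‖ ^ 2 < 0 := by
    obtain ⟨p, hp⟩ := Function.ne_iff.mp hw0
    refine Finset.sum_neg' (fun i _ => ?_) ⟨p, Finset.mem_univ _, ?_⟩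
    · by_cases hi : i ∈ P
      · exact mul_nonpos_of_nonpos_of_nonneg (Finset.mem_filter.mp hi).2.le (sq_nonneg _)
      · simp [hzP' i hi]
    · refine mul_neg_of_neg_of_pos (Finset.mem_filter.mp p.2).2 ?_
      rw [hzP]
      exact pow_pos (norm_pos_iff.mpr hp) 2
  rw [hdiag] at hnonneg
  exact absurd (Complex.zero_le_real.mp hnonneg) hneg.not_ge

/-- Positive definiteness tested against a finitely supported function on a finite semigroup. -/
lemma IsPosDefFn.sum_nonneg {S : Type*} [Fintype S] {add : S → S → S} {st : S → S} {φ : S → ℂ}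
    (hφ : IsPosDefFn add st φ) (ξ : S → ℂ) :
    0 ≤ ∑ s, ∑ t, ξ s * starRingEnd ℂ (ξ t) * φ (add (st t) s) := by
  let e := (Fintype.equivFin S).symm
  have h := hφ _ e (ξ ∘ e)
  rw [← e.sum_comp]
  simp_rw [← e.sum_comp (fun t => ξ _ * starRingEnd ℂ (ξ t) * φ (add (st t) _))]
  exact h

/-- The nontrivial character of `ℤ/2ℤ`. -/
def sgn2 (x : ZMod 2) : ℤ := if x = 0 then 1 else -1

/-- The six characters of `U(ℤ/2ℤ × ℤ/2ℤ, ℤ/2ℤ, π)`: those of the group `ℤ/2ℤ × ℤ/2ℤ`, extended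
by zero, and those of `ℤ/2ℤ`, composed with `π` on `ℤ/2ℤ × ℤ/2ℤ`. -/
def char16 : (ZMod 2 × ZMod 2) ⊕ ZMod 2 → (ZMod 2 × ZMod 2) ⊕ ZMod 2 → ℤ
  | Sum.inl (a, b), Sum.inl (x, y) => sgn2 (a * x + b * y)
  | Sum.inl _, Sum.inr _ => 0
  | Sum.inr a, Sum.inl (x, _) => sgn2 (a * x)
  | Sum.inr a, Sum.inr x => sgn2 (a * x)

/-- Four times the basis dual to the characters `char16`. -/
def dual16 : (ZMod 2 × ZMod 2) ⊕ ZMod 2 → (ZMod 2 × ZMod 2) ⊕ ZMod 2 → ℤ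
  | Sum.inl (a, b), Sum.inl (x, y) => sgn2 (a * x + b * y)
  | Sum.inl (a, b), Sum.inr x => if b = 0 then -2 * sgn2 (a * x) else 0
  | Sum.inr _, Sum.inl _ => 0
  | Sum.inr a, Sum.inr x => 2 * sgn2 (a * x)

/-- The coefficient of the character `χ` in `φ`. -/
noncomputable def coeff16 (φ : (ZMod 2 × ZMod 2) ⊕ ZMod 2 → ℂ)
    (χ : (ZMod 2 × ZMod 2) ⊕ ZMod 2) : ℂ :=
  4⁻¹ * ∑ s, dual16 χ s * φ s

lemma st16_eq (s : (ZMod 2 × ZMod 2) ⊕ ZMod 2) : st16 s = s := by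
  revert s; decide

lemma char16_add (χ s t : (ZMod 2 × ZMod 2) ⊕ ZMod 2) :
    char16 χ (add16 s t) = char16 χ s * char16 χ t := by
  revert χ s t; decide

lemma sum_dual16_mul_char16 (s t : (ZMod 2 × ZMod 2) ⊕ ZMod 2) :
    ∑ χ, dual16 χ t * char16 χ s = if t = s then 4 else 0 := by
  revert s t; decide

lemma eq_sum_coeff16 (φ : (ZMod 2 × ZMod 2) ⊕ ZMod 2 → ℂ) (s : (ZMod 2 × ZMod 2) ⊕ ZMod 2) :
    φ s = ∑ χ, coeff16 φ χ * char16 χ s := by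
  have h (t) : ∑ χ, (dual16 χ t : ℂ) * char16 χ s = if t = s then 4 else 0 := by
    exact_mod_cast congrArg (Int.cast : ℤ → ℂ) (sum_dual16_mul_char16 s t)
  calc φ s = 4⁻¹ * ∑ t, (∑ χ, (dual16 χ t : ℂ) * char16 χ s) * φ t := by simp [h]
    _ = ∑ χ, coeff16 φ χ * char16 χ s := by
      simp only [coeff16, Finset.mul_sum, Finset.sum_mul]
      rw [Finset.sum_comm]
      exact Finset.sum_congr rfl fun _ _ => Finset.sum_congr rfl fun _ _ => by ring

lemma sum_dual16_mul_char16_left (χ χ' : (ZMod 2 × ZMod 2) ⊕ ZMod 2) :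
    ∑ s, dual16 χ s * char16 χ' s = if χ' = χ then 4 else 0 := by
  revert χ χ'; decide

lemma coeff16_nonneg {φ : (ZMod 2 × ZMod 2) ⊕ ZMod 2 → ℂ} (hφ : IsPosDefFn add16 st16 φ)
    (χ : (ZMod 2 × ZMod 2) ⊕ ZMod 2) : 0 ≤ coeff16 φ χ := by
  have h (χ') : ∑ s, (dual16 χ s : ℂ) * char16 χ' s = if χ' = χ then 4 else 0 := by
    exact_mod_cast congrArg (Int.cast : ℤ → ℂ) (sum_dual16_mul_char16_left χ χ')
  have key : ∑ s, ∑ t, (dual16 χ s : ℂ) * starRingEnd ℂ (dual16 χ t : ℂ) *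
      φ (add16 (st16 t) s) = 16 * coeff16 φ χ := by
    calc _ = ∑ χ', coeff16 φ χ' * ((∑ s, (dual16 χ s : ℂ) * char16 χ' s) *
          ∑ t, (dual16 χ t : ℂ) * char16 χ' t) := by
          simp only [eq_sum_coeff16 φ (add16 _ _), st16_eq, char16_add]
          simp only [Finset.sum_mul, Finset.mul_sum]
          rw [Finset.sum_congr rfl fun i _ => Finset.sum_comm, Finset.sum_comm]
          refine Finset.sum_congr rfl fun _ _ => Finset.sum_congr rfl fun _ _ =>
            Finset.sum_congr rfl fun _ _ => ?_
          simp
          ring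
      _ = 16 * coeff16 φ χ := by simp [h]; ring
  have hpos := hφ.sum_nonneg fun s => (dual16 χ s : ℂ)
  rw [key] at hpos
  exact le_of_mul_le_mul_left (by simpa using hpos) (by norm_num : (0 : ℂ) < 16)

/-- The shift by `u` of a positive definite function has at most as many negative squares as
there are characters that are negative at `u`. -/
lemma negSquaresLE_shift {φ : (ZMod 2 × ZMod 2) ⊕ ZMod 2 → ℂ} (hφ : IsPosDefFn add16 st16 φ)
    (u : (ZMod 2 × ZMod 2) ⊕ ZMod 2) :
    NegSquaresLE add16 st16 (fun s => φ (add16 s u))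
      (Finset.univ.filter fun χ => char16 χ u < 0).card := by
  intro n s h
  refine negEigCount_le_card_of_eq_sum h _ (fun χ => coeff16 φ χ * char16 χ u)
    (fun χ i => char16 χ (s i)) (fun i j => ?_) fun χ hχ => ?_
  · simp only [Matrix.of_apply, eq_sum_coeff16 φ (add16 _ _), st16_eq, char16_add]
    refine Finset.sum_congr rfl fun _ _ => ?_
    push_cast
    ring
  · refine mul_nonneg (coeff16_nonneg hφ χ) ?_
    have : 0 ≤ char16 χ u := by simpa using hχ
    exact_mod_cast this

/-- Let `S = U(ℤ/2ℤ × ℤ/2ℤ, ℤ/2ℤ, π)` with `π(x,y) = x`, componentwise additions and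
identical involutions; `(0,0)` is the neutral element of `S`.  Then `(1,0) + s ≠ s`
for every `s ∈ S`, whereas `(0,1) + s ≠ s` holds exactly for the four elements of the
`ℤ/2ℤ × ℤ/2ℤ` part of `S`.  Consequently, for every positive definite `φ : S → ℂ` the
number of negative squares of `s ↦ φ(s+(1,0))` is at most `3` and the number of
negative squares of `s ↦ φ(s+(0,1))` is at most `2`. -/
theorem stmt16 :
    (∀ s : (ZMod 2 × ZMod 2) ⊕ ZMod 2, add16 (Sum.inl (1, 0)) s ≠ s) ∧
    (∀ s : (ZMod 2 × ZMod 2) ⊕ ZMod 2,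
      add16 (Sum.inl (0, 1)) s ≠ s ↔ ∃ p : ZMod 2 × ZMod 2, s = Sum.inl p) ∧
    (∀ φ : (ZMod 2 × ZMod 2) ⊕ ZMod 2 → ℂ, IsPosDefFn add16 st16 φ →
      NegSquaresLE add16 st16 (fun s => φ (add16 s (Sum.inl (1, 0)))) 3 ∧
      NegSquaresLE add16 st16 (fun s => φ (add16 s (Sum.inl (0, 1)))) 2) := by
  refine ⟨by decide, by decide, fun φ hφ => ⟨?_, ?_⟩⟩
  · exact negSquaresLE_shift hφ (Sum.inl (1, 0))
  · exact negSquaresLE_shift hφ (Sum.inl (0, 1))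
end

section
/- If H and K are *-archimedean components of a commutative *-semigroup S, then there exists a *-archimedean component L of S with H + K ⊆ L, where H + K = {h + k : h ∈ H, k ∈ K}. -/
open scoped ComplexOrder

/-- `repAdd add a m` is the `(m+1)`-fold sum `a + a + ⋯ + a`. -/
def repAdd {S : Type*} (add : S → S → S) (a : S) : ℕ → S
  | 0 => a
  | n + 1 => add a (repAdd add a n)

/-- `H` is a `*`-subsemigroup: nonempty and closed under `add` and `st`. -/
def IsStarSubsemigroup {S : Type*} (add : S → S → S) (st : S → S) (H : Set S) : Prop :=
  H.Nonempty ∧ (∀ a ∈ H, ∀ b ∈ H, add a b ∈ H) ∧ ∀ a ∈ H, st a ∈ H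

/-- `H` is a `*`-archimedean `*`-subsemigroup: for all `s t ∈ H` there are `m ≥ 1`
and `x ∈ H` with `m • (s + s*) = t + x`. -/
def IsStarArchimedean {S : Type*} (add : S → S → S) (st : S → S) (H : Set S) : Prop :=
  IsStarSubsemigroup add st H ∧
    ∀ s ∈ H, ∀ t ∈ H, ∃ (m : ℕ) (x : S), x ∈ H ∧ repAdd add (add s (st s)) m = add t x

/-- `H` is a `*`-archimedean component: a maximal `*`-archimedean `*`-subsemigroup. -/
def IsArchComponent {S : Type*} (add : S → S → S) (st : S → S) (H : Set S) : Prop :=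
  IsStarArchimedean add st H ∧
    ∀ K : Set S, IsStarArchimedean add st K → H ⊆ K → K = H

theorem repAdd_add {S : Type*} {add : S → S → S} (hcomm : ∀ a b, add a b = add b a)
    (hassoc : ∀ a b c, add (add a b) c = add a (add b c)) (a b : S) (m : ℕ) :
    repAdd add (add a b) m = add (repAdd add a m) (repAdd add b m) := by
  have : Std.Commutative add := ⟨hcomm⟩
  have : Std.Associative add := ⟨hassoc⟩
  induction m with
  | zero => rfl
  | succ m ih =>
    simp only [repAdd, ih]
    ac_rfl

/-- In a `*`-archimedean `*`-subsemigroup, the multiples of `s + s*` are divisible by `t`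
from some point on. -/
theorem IsStarArchimedean.exists_forall_ge {S : Type*} {add : S → S → S} {st : S → S}
    (hcomm : ∀ a b, add a b = add b a)
    (hassoc : ∀ a b c, add (add a b) c = add a (add b c)) {H : Set S}
    (hH : IsStarArchimedean add st H) {s t : S} (hs : s ∈ H) (ht : t ∈ H) :
    ∃ m : ℕ, ∀ n, m ≤ n → ∃ x ∈ H, repAdd add (add s (st s)) n = add t x := by
  obtain ⟨⟨_, hadd, hst⟩, harch⟩ := hH
  obtain ⟨m, x, hx, hm⟩ := harch s hs t ht
  have : Std.Commutative add := ⟨hcomm⟩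
  have : Std.Associative add := ⟨hassoc⟩
  refine ⟨m, fun n hn => ?_⟩
  induction n, hn using Nat.le_induction with
  | base => exact ⟨x, hx, hm⟩
  | succ n _ ih =>
    obtain ⟨y, hy, hn⟩ := ih
    refine ⟨add (add s (st s)) y, hadd _ (hadd _ hs _ (hst _ hs)) _ hy, ?_⟩
    simp only [repAdd, hn]
    ac_rfl

theorem IsStarArchimedean.image2_add {S : Type*} {add : S → S → S} {st : S → S}
    (hcomm : ∀ a b, add a b = add b a)
    (hassoc : ∀ a b c, add (add a b) c = add a (add b c))
    (hstadd : ∀ a b, st (add a b) = add (st a) (st b)) {H K : Set S}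
    (hH : IsStarArchimedean add st H) (hK : IsStarArchimedean add st K) :
    IsStarArchimedean add st (Set.image2 add H K) := by
  have : Std.Commutative add := ⟨hcomm⟩
  have : Std.Associative add := ⟨hassoc⟩
  refine ⟨⟨hH.1.1.image2 hK.1.1, ?_, ?_⟩, ?_⟩
  · rintro _ ⟨a, ha, b, hb, rfl⟩ _ ⟨c, hc, d, hd, rfl⟩
    exact ⟨add a c, hH.1.2.1 a ha c hc, add b d, hK.1.2.1 b hb d hd, by ac_rfl⟩
  · rintro _ ⟨a, ha, b, hb, rfl⟩
    exact ⟨st a, hH.1.2.2 a ha, st b, hK.1.2.2 b hb, (hstadd a b).symm⟩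
  · rintro _ ⟨a, ha, b, hb, rfl⟩ _ ⟨c, hc, d, hd, rfl⟩
    obtain ⟨m, hm⟩ := hH.exists_forall_ge hcomm hassoc ha hc
    obtain ⟨n, hn⟩ := hK.exists_forall_ge hcomm hassoc hb hd
    obtain ⟨x, hx, hmx⟩ := hm (max m n) (le_max_left m n)
    obtain ⟨y, hy, hny⟩ := hn (max m n) (le_max_right m n)
    refine ⟨max m n, add x y, ⟨x, hx, y, hy, rfl⟩, ?_⟩
    have key : add (add a b) (st (add a b)) = add (add a (st a)) (add b (st b)) := by
      rw [hstadd]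
      ac_rfl
    rw [key, repAdd_add hcomm hassoc, hmx, hny]
    ac_rfl

theorem IsStarArchimedean.sUnion {S : Type*} {add : S → S → S} {st : S → S}
    {c : Set (Set S)} (hc : ∀ H ∈ c, IsStarArchimedean add st H) (hchain : IsChain (· ⊆ ·) c)
    (hne : c.Nonempty) : IsStarArchimedean add st (⋃₀ c) := by
  have common : ∀ a ∈ ⋃₀ c, ∀ b ∈ ⋃₀ c, ∃ H ∈ c, a ∈ H ∧ b ∈ H := by
    rintro a ⟨H, hH, ha⟩ b ⟨K, hK, hb⟩
    rcases hchain.total hH hK with h | h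
    · exact ⟨K, hK, h ha, hb⟩
    · exact ⟨H, hH, ha, h hb⟩
  refine ⟨⟨?_, ?_, ?_⟩, ?_⟩
  · obtain ⟨H, hH⟩ := hne
    obtain ⟨a, ha⟩ := (hc H hH).1.1
    exact ⟨a, H, hH, ha⟩
  · intro a ha b hb
    obtain ⟨H, hH, haH, hbH⟩ := common a ha b hb
    exact ⟨H, hH, (hc H hH).1.2.1 a haH b hbH⟩
  · rintro a ⟨H, hH, ha⟩
    exact ⟨H, hH, (hc H hH).1.2.2 a ha⟩
  · intro s hs t ht
    obtain ⟨H, hH, hsH, htH⟩ := common s hs t ht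
    obtain ⟨m, x, hx, hm⟩ := (hc H hH).2 s hsH t htH
    exact ⟨m, x, ⟨H, hH, hx⟩, hm⟩

/-- Every `*`-archimedean `*`-subsemigroup lies in a `*`-archimedean component. -/
theorem IsStarArchimedean.exists_isArchComponent {S : Type*} {add : S → S → S} {st : S → S}
    {H : Set S} (hH : IsStarArchimedean add st H) :
    ∃ L, IsArchComponent add st L ∧ H ⊆ L := by
  obtain ⟨L, hHL, hL⟩ := zorn_subset_nonempty {K | IsStarArchimedean add st K}
    (fun c hc hchain hne =>
      ⟨⋃₀ c, IsStarArchimedean.sUnion hc hchain hne, fun _ => Set.subset_sUnion_of_mem⟩) H hH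
  exact ⟨L, ⟨hL.prop, fun K hK hLK => (hL.eq_of_subset hK hLK).symm⟩, hHL⟩

/-- If `H` and `K` are `*`-archimedean components of a commutative `*`-semigroup `S`,
then there is a `*`-archimedean component `L` of `S` with `H + K ⊆ L`. -/
theorem stmt18 {S : Type*} (add : S → S → S) (st : S → S)
    (hcomm : ∀ a b, add a b = add b a)
    (hassoc : ∀ a b c, add (add a b) c = add a (add b c))
    (hstadd : ∀ a b, st (add a b) = add (st a) (st b))
    (hstinv : ∀ a, st (st a) = a)
    (H K : Set S) (hH : IsArchComponent add st H) (hK : IsArchComponent add st K) :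
    ∃ L : Set S, IsArchComponent add st L ∧ ∀ a ∈ H, ∀ b ∈ K, add a b ∈ L := by
  obtain ⟨L, hL, hsub⟩ :=
    (hH.1.image2_add hcomm hassoc hstadd hK.1).exists_isArchComponent
  exact ⟨L, hL, fun a ha b hb => hsub ⟨a, ha, b, hb, rfl⟩⟩
end

section
/- Let T = ℤ/2ℤ × ℕ with the operation (x,n) + (y,m) = (x+y, max(n,m)) and the identical involution s* = s. Then T is *-separative, and there exist infinitely many characters σ on T with σ((1,0)) = -1; moreover (1,0) + s ≠ s for every s ∈ T. -/
open scoped ComplexOrder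

/-- `σ : S → ℂ` is a character on the commutative `*`-semigroup `(S, add, st)`:
it is not identically zero, multiplicative and `*`-preserving. -/
def IsChar {S : Type*} (add : S → S → S) (st : S → S) (σ : S → ℂ) : Prop :=
  (∃ s, σ s ≠ 0) ∧ (∀ a b, σ (add a b) = σ a * σ b) ∧
    (∀ a, σ (st a) = starRingEnd ℂ (σ a))

/-- The operation `(x,n) + (y,m) = (x+y, max n m)` on `T = ℤ/2ℤ × ℕ`. -/
def add19 : ZMod 2 × ℕ → ZMod 2 × ℕ → ZMod 2 × ℕ :=
  fun a b => (a.1 + b.1, max a.2 b.2)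

/-- The function on `ℤ/2ℤ × ℕ` given by `x ↦ ε ^ x` on the levels `n ≤ k` and by `0` above. -/
noncomputable def levelChar (ε : ℂ) (k : ℕ) (s : ZMod 2 × ℕ) : ℂ :=
  if s.2 ≤ k then ε ^ s.1.val else 0

theorem levelChar_of_le (ε : ℂ) {k n : ℕ} (h : n ≤ k) (x : ZMod 2) :
    levelChar ε k (x, n) = ε ^ x.val := if_pos h

theorem levelChar_of_lt (ε : ℂ) {k n : ℕ} (h : k < n) (x : ZMod 2) :
    levelChar ε k (x, n) = 0 := if_neg h.not_ge

theorem pow_val_add {M : Type*} [Monoid M] {ε : M} (hε : ε ^ 2 = 1) (x y : ZMod 2) :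
    ε ^ (x + y).val = ε ^ x.val * ε ^ y.val := by
  rw [ZMod.val_add, ← pow_add, ← pow_eq_pow_mod _ hε]

theorem isChar_levelChar {ε : ℂ} (hε : ε ^ 2 = 1) (k : ℕ) :
    IsChar add19 id (levelChar ε k) := by
  refine ⟨⟨(0, 0), by simp [levelChar]⟩, ?_, ?_⟩
  · rintro ⟨x, n⟩ ⟨y, m⟩
    by_cases hn : n ≤ k <;> by_cases hm : m ≤ k <;>
      simp [levelChar, add19, hn, hm, pow_val_add hε]
  · rintro ⟨x, n⟩
    rcases sq_eq_sq_iff_eq_or_eq_neg.mp (hε.trans (one_pow 2).symm) with rfl | rfl <;>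
      by_cases hn : n ≤ k <;> simp [levelChar, hn]

theorem levelChar_ne_of_lt {ε : ℂ} (hε : ε ≠ 0) {n m : ℕ} (h : n < m) (x y : ZMod 2) :
    levelChar ε n (x, n) ≠ levelChar ε n (y, m) := by
  rw [levelChar_of_le ε le_rfl, levelChar_of_lt ε h]
  exact pow_ne_zero _ hε

theorem levelChar_injective {ε : ℂ} (hε : ε ≠ 0) : Function.Injective (levelChar ε) := by
  have key {k l : ℕ} (h : k < l) : levelChar ε k ≠ levelChar ε l := fun he => by
    have := congrFun he (0, l)
    rw [levelChar_of_lt ε h, levelChar_of_le ε le_rfl] at this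
    exact pow_ne_zero _ hε this.symm
  intro k l he
  by_contra hne
  rcases lt_or_gt_of_ne hne with h | h
  · exact key h he
  · exact key h he.symm

theorem neg_one_pow_val_injective :
    Function.Injective fun x : ZMod 2 => (-1 : ℂ) ^ x.val := by
  intro x y h
  fin_cases x <;> fin_cases y <;> first | rfl | norm_num [ZMod.val] at h

/-- Let `T = ℤ/2ℤ × ℕ` with the operation `(x,n) + (y,m) = (x+y, max n m)` and the
identical involution.  Then `T` is `*`-separative, there exist infinitely many
characters `σ` on `T` with `σ (1,0) = -1`, and `(1,0) + s ≠ s` for every `s ∈ T`. -/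
theorem stmt19 :
    (∀ a b : ZMod 2 × ℕ, a ≠ b →
      ∃ σ : ZMod 2 × ℕ → ℂ, IsChar add19 id σ ∧ σ a ≠ σ b) ∧
    {σ : ZMod 2 × ℕ → ℂ | IsChar add19 id σ ∧ σ (1, 0) = -1}.Infinite ∧
    (∀ s : ZMod 2 × ℕ, add19 (1, 0) s ≠ s) := by
  refine ⟨?_, ?_, ?_⟩
  · rintro ⟨x, n⟩ ⟨y, m⟩ hab
    rcases lt_trichotomy n m with h | rfl | h
    · exact ⟨_, isChar_levelChar (one_pow 2) n, levelChar_ne_of_lt one_ne_zero h x y⟩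
    · refine ⟨_, isChar_levelChar neg_one_sq n, ?_⟩
      rw [levelChar_of_le _ le_rfl, levelChar_of_le _ le_rfl]
      exact fun h => hab (congrArg (·, n) (neg_one_pow_val_injective h))
    · exact ⟨_, isChar_levelChar (one_pow 2) m, (levelChar_ne_of_lt one_ne_zero h y x).symm⟩
  · refine Set.infinite_of_injective_forall_mem
      (levelChar_injective (neg_ne_zero.mpr one_ne_zero)) fun k => ⟨isChar_levelChar neg_one_sq k, ?_⟩
    rw [levelChar_of_le _ k.zero_le, ZMod.val_one, pow_one]
  · intro s h
    have h₁ : 1 + s.1 = s.1 := congrArg Prod.fst h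
    exact one_ne_zero (add_eq_right.mp h₁)
end
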